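/- For every integer n ≥ 1 and i ∈ {1,2}, the following connection formula holds as an identity of polynomials in x: Q_n^{(i)}(x) = M_n(x) − λ · (𝒟_i^j M_n(α) / (1 + λ K_{n−1}^{(j,j)}(α,α))) · K_{n−1}^{(0,j)}(x,α). -/

import Mathlib

open Finset Filter Topology Polynomial

noncomputable section

/-- Pochhammer symbol `(a)_k = a(a+1)⋯(a+k−1)`. -/
def poch (a : ℝ) (k : ℕ) : ℝ := ∏ m ∈ Finset.range k, (a + m)

/-- Falling factorial `[x]_k = x(x−1)⋯(x−k+1)`. -/
def fall (x : ℝ) (k : ℕ) : ℝ := ∏ m ∈ Finset.range k, (x - m)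

/-- `⟨x⟩_i^k`: falling factorial for `i = 1`, Pochhammer symbol for `i = 2`. -/
def br (i : ℕ) (x : ℝ) (k : ℕ) : ℝ := if i = 1 then fall x k else poch x k

/-- Forward (`i = 1`) resp. backward (`i = 2`) difference operator `𝒟_i`. -/
def Dop (i : ℕ) (f : ℝ → ℝ) : ℝ → ℝ :=
  fun x => if i = 1 then f (x + 1) - f x else f x - f (x - 1)

/-- Iterated difference operator `𝒟_i^k`. -/
def Dk (i k : ℕ) (f : ℝ → ℝ) : ℝ → ℝ := (Dop i)^[k] f

/-- Kronecker delta `δ_{i,m}` (real valued). -/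
def kdelta (i m : ℕ) : ℝ := if i = m then 1 else 0

/-- The shift `x ± 1`: `x + 1` for `i = 1`, `x - 1` for `i = 2`. -/
def sh (i : ℕ) (x : ℝ) : ℝ := if i = 1 then x + 1 else x - 1

/-- Monic Meixner polynomial `M_n(x)`. -/
def MeixnerM (γ μ : ℝ) (n : ℕ) (x : ℝ) : ℝ :=
  poch γ n * (μ / (μ - 1)) ^ n *
    ∑ k ∈ Finset.range (n + 1),
      poch (-(n : ℝ)) k * poch (-x) k / poch γ k * (1 - μ⁻¹) ^ k / (Nat.factorial k : ℝ)

/-- Meixner inner product `⟨p,q⟩ = ∑_{x≥0} p(x)q(x) μ^x (γ)_x / x!`. -/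
def mIP (γ μ : ℝ) (p q : ℝ → ℝ) : ℝ :=
  ∑' x : ℕ, p x * q x * μ ^ x * poch γ x / (Nat.factorial x : ℝ)

/-- Squared Meixner norm `‖M_n‖²`. -/
def nrm2 (γ μ : ℝ) (n : ℕ) : ℝ := mIP γ μ (MeixnerM γ μ n) (MeixnerM γ μ n)

/-- Kernel `K_n^{(l,m)}(x,y)` for the operator `𝒟_i`. -/
def Klm (γ μ : ℝ) (i l m n : ℕ) (x y : ℝ) : ℝ :=
  ∑ k ∈ Finset.range (n + 1),
    Dk i l (MeixnerM γ μ k) x * Dk i m (MeixnerM γ μ k) y / nrm2 γ μ k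

/-- Sobolev inner product `⟨p,q⟩_λ = ⟨p,q⟩ + λ 𝒟_i^j p(α) 𝒟_i^j q(α)`. -/
def sIP (γ μ lam α : ℝ) (i j : ℕ) (p q : ℝ → ℝ) : ℝ :=
  mIP γ μ p q + lam * Dk i j p α * Dk i j q α

/-- `Q` is the monic Sobolev orthogonal polynomial of degree `n`. -/
def IsSobolevOP (γ μ lam α : ℝ) (i j n : ℕ) (Q : Polynomial ℝ) : Prop :=
  Q.Monic ∧ Q.natDegree = n ∧
    ∀ p : Polynomial ℝ, p.degree < (n : WithBot ℕ) →
      sIP γ μ lam α i j (fun x => Q.eval x) (fun x => p.eval x) = 0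

/-- Coefficient `a_n^{(k)}`. -/
def acoef (γ μ lam α : ℝ) (i j n k : ℕ) : ℝ :=
  -(lam * (Nat.factorial j : ℝ) * Dk i j (MeixnerM γ μ n) α * Dk i k (MeixnerM γ μ (n - 1)) α) /
    ((Nat.factorial k : ℝ) * nrm2 γ μ (n - 1) * (1 + lam * Klm γ μ i j j (n - 1) α α))

/-- Coefficient `b_n^{(k)}`. -/
def bcoef (γ μ lam α : ℝ) (i j n k : ℕ) : ℝ :=
  lam * (Nat.factorial j : ℝ) * Dk i j (MeixnerM γ μ n) α * Dk i k (MeixnerM γ μ n) α /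
    ((Nat.factorial k : ℝ) * nrm2 γ μ (n - 1) * (1 + lam * Klm γ μ i j j (n - 1) α α))

/-- Rational function `A_{1,n}(x)`. -/
def A1 (γ μ lam α : ℝ) (i j n : ℕ) (x : ℝ) : ℝ :=
  1 + (1 / br i (x - α) (j + 1)) *
    ∑ k ∈ Finset.range (j + 1), acoef γ μ lam α i j n k * br i (x - α) k

/-- Rational function `B_{1,n}(x)`. -/
def B1 (γ μ lam α : ℝ) (i j n : ℕ) (x : ℝ) : ℝ :=
  (1 / br i (x - α) (j + 1)) *
    ∑ k ∈ Finset.range (j + 1), bcoef γ μ lam α i j n k * br i (x - α) k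

/-- Meixner recurrence coefficient `α_n`. -/
def alphaR (γ μ : ℝ) (n : ℕ) : ℝ := ((n : ℝ) * (1 + μ) + μ * γ) / (1 - μ)

/-- Meixner recurrence coefficient `β_n`. -/
def betaR (γ μ : ℝ) (n : ℕ) : ℝ := (n : ℝ) * μ * ((n : ℝ) + γ - 1) / (1 - μ) ^ 2

/-- Rational function `A_{2,n}(x)`. -/
def A2 (γ μ lam α : ℝ) (i j n : ℕ) (x : ℝ) : ℝ :=
  -(B1 γ μ lam α i j (n - 1) x) / betaR γ μ (n - 1)

/-- Rational function `B_{2,n}(x)`. -/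
def B2 (γ μ lam α : ℝ) (i j n : ℕ) (x : ℝ) : ℝ :=
  A1 γ μ lam α i j (n - 1) x + A2 γ μ lam α i j n x * (alphaR γ μ (n - 1) - x)

/-- Rational function `C_{1,n}(x)`. -/
def C1 (γ μ lam α : ℝ) (i j n : ℕ) (x : ℝ) : ℝ :=
  (x + γ * kdelta i 1) * Dop i (A1 γ μ lam α i j n) x + (n : ℝ) * A1 γ μ lam α i j n (sh i x)
    - ((n : ℝ) - 1) * ((n : ℝ) + γ - 2) * μ ^ kdelta i 2 * B1 γ μ lam α i j n (sh i x) /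
        (betaR γ μ (n - 1) * (1 - μ))

/-- Rational function `D_{1,n}(x)`. -/
def D1 (γ μ lam α : ℝ) (i j n : ℕ) (x : ℝ) : ℝ :=
  (x + γ * kdelta i 1) * Dop i (B1 γ μ lam α i j n) x
    + ((n : ℝ) - 1) * B1 γ μ lam α i j n (sh i x)
    + ((n : ℝ) - 1) * ((n : ℝ) + γ - 2) * (x - alphaR γ μ (n - 1)) * μ ^ kdelta i 2 *
        B1 γ μ lam α i j n (sh i x) / (betaR γ μ (n - 1) * (1 - μ))
    + (n : ℝ) * ((n : ℝ) + γ - 1) * μ ^ kdelta i 2 * A1 γ μ lam α i j n (sh i x) / (1 - μ)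

/-- Rational function `C_{2,n}(x)`. -/
def C2 (γ μ lam α : ℝ) (i j n : ℕ) (x : ℝ) : ℝ :=
  -(D1 γ μ lam α i j (n - 1) x) / betaR γ μ (n - 1)

/-- Rational function `D_{2,n}(x)`. -/
def D2 (γ μ lam α : ℝ) (i j n : ℕ) (x : ℝ) : ℝ :=
  C1 γ μ lam α i j (n - 1) x + C2 γ μ lam α i j n x * (alphaR γ μ (n - 1) - x)

/-- `A_{m,n}(x)` for `m = 1, 2`. -/
def Aa (γ μ lam α : ℝ) (i j n m : ℕ) (x : ℝ) : ℝ :=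
  if m = 1 then A1 γ μ lam α i j n x else A2 γ μ lam α i j n x

/-- `B_{m,n}(x)` for `m = 1, 2`. -/
def Bb (γ μ lam α : ℝ) (i j n m : ℕ) (x : ℝ) : ℝ :=
  if m = 1 then B1 γ μ lam α i j n x else B2 γ μ lam α i j n x

/-- `C_{k,n}(x)` for `k = 1, 2`. -/
def Cc (γ μ lam α : ℝ) (i j n k : ℕ) (x : ℝ) : ℝ :=
  if k = 1 then C1 γ μ lam α i j n x else C2 γ μ lam α i j n x

/-- `D_{k,n}(x)` for `k = 1, 2`. -/
def Dd (γ μ lam α : ℝ) (i j n k : ℕ) (x : ℝ) : ℝ :=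
  if k = 1 then D1 γ μ lam α i j n x else D2 γ μ lam α i j n x

/-- `Λ_{m,n}^{(k)}(x) = (−1)^k (C_{k,n}(x) B_{m,n}(x) − A_{m,n}(x) D_{k,n}(x))`. -/
def Lam (γ μ lam α : ℝ) (i j n m k : ℕ) (x : ℝ) : ℝ :=
  (-1 : ℝ) ^ k * (Cc γ μ lam α i j n k x * Bb γ μ lam α i j n m x
    - Aa γ μ lam α i j n m x * Dd γ μ lam α i j n k x)

/-- `Θ_n(x) = A_{1,n}(x) B_{2,n}(x) − B_{1,n}(x) A_{2,n}(x)`. -/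
def Theta (γ μ lam α : ℝ) (i j n : ℕ) (x : ℝ) : ℝ :=
  A1 γ μ lam α i j n x * B2 γ μ lam α i j n x - B1 γ μ lam α i j n x * A2 γ μ lam α i j n x

/-- `Θ̃_n(x) = (x + γ δ_{i,1}) Θ_n(x)`. -/
def Thetatil (γ μ lam α : ℝ) (i j n : ℕ) (x : ℝ) : ℝ :=
  (x + γ * kdelta i 1) * Theta γ μ lam α i j n x

theorem poch_eq_eval_ascPochhammer (a : ℝ) (k : ℕ) : poch a k = (ascPochhammer ℝ k).eval a := by
  induction k with
  | zero => simp [poch]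
  | succ k ih => rw [ascPochhammer_succ_eval, ← ih, poch, poch, Finset.prod_range_succ]

theorem poch_succ (a : ℝ) (k : ℕ) : poch a (k + 1) = poch a k * (a + k) :=
  Finset.prod_range_succ _ _

theorem poch_pos {a : ℝ} (ha : 0 < a) (k : ℕ) : 0 < poch a k :=
  Finset.prod_pos fun _ _ => by positivity

theorem poch_add (a : ℝ) (k m : ℕ) : poch a (k + m) = poch a k * poch (a + k) m := by
  simp [poch, Finset.prod_range_add, add_assoc]

theorem poch_neg (x : ℝ) (k : ℕ) : poch (-x) k = (-1) ^ k * (descPochhammer ℝ k).eval x := by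
  rw [poch_eq_eval_ascPochhammer, ascPochhammer_eval_neg_eq_descPochhammer]

theorem poch_neg_natCast_div_factorial (n k : ℕ) :
    poch (-(n : ℝ)) k / (k.factorial : ℝ) = (-1) ^ k * (n.choose k : ℝ) := by
  rw [poch_neg, descPochhammer_eval_eq_descFactorial, Nat.descFactorial_eq_factorial_mul_choose]
  have : (k.factorial : ℝ) ≠ 0 := by positivity
  push_cast
  field_simp

/-- A linear functional vanishing on a family of monic polynomials of degrees `0, …, n - 1`
vanishes on all polynomials of degree less than `n`. -/
theorem eq_zero_of_vanish_on_monic_family {b : ℕ → ℝ[X]} (hb : ∀ k, (b k).Monic)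
    (hd : ∀ k, (b k).natDegree = k) (φ : ℝ[X] →ₗ[ℝ] ℝ) (n : ℕ) (h : ∀ k < n, φ (b k) = 0)
    (p : ℝ[X]) (hp : p.degree < (n : WithBot ℕ)) : φ p = 0 := by
  induction n generalizing p with
  | zero =>
    have : p = 0 := by
      rw [← Polynomial.degree_eq_bot]
      simpa using hp
    simp [this]
  | succ n ih =>
    have hq : (p - p.coeff n • b n).degree < (n : WithBot ℕ) := by
      rw [Polynomial.degree_lt_iff_coeff_zero] at hp ⊢
      intro m hm
      rcases hm.eq_or_lt with rfl | hm
      · have := hb n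
        rw [Polynomial.Monic, Polynomial.leadingCoeff, hd] at this
        simp [this]
      · rw [Polynomial.coeff_sub, hp m hm, Polynomial.coeff_smul,
          Polynomial.coeff_eq_zero_of_natDegree_lt (p := b n) (by rwa [hd])]
        simp
    have := ih (fun k hk => h k (by omega)) _ hq
    rw [map_sub, map_smul, h n (by omega)] at this
    simpa using this

/-- The Meixner weight `μ^x (γ)_x / x!`. -/
def meixnerWeight (γ μ : ℝ) (x : ℕ) : ℝ := μ ^ x * poch γ x / (x.factorial : ℝ)

theorem meixnerWeight_pos {γ μ : ℝ} (hγ : 0 < γ) (hμ0 : 0 < μ) (x : ℕ) :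
    0 < meixnerWeight γ μ x := by
  have := poch_pos hγ x
  unfold meixnerWeight
  positivity

/-- The Pearson equation for the Meixner weight. -/
theorem succ_mul_meixnerWeight_succ (γ μ : ℝ) (x : ℕ) :
    ((x : ℝ) + 1) * meixnerWeight γ μ (x + 1) = μ * ((x + γ) * meixnerWeight γ μ x) := by
  have : (x.factorial : ℝ) ≠ 0 := by positivity
  have : (x : ℝ) + 1 ≠ 0 := by positivity
  rw [meixnerWeight, meixnerWeight, poch_succ, Nat.factorial_succ]
  push_cast
  field_simp
  ring

theorem summable_pow_mul_meixnerWeight {γ μ : ℝ} (hγ : 0 < γ) (hμ0 : 0 < μ) (hμ1 : μ < 1)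
    (m : ℕ) : Summable fun x : ℕ => (x : ℝ) ^ m * meixnerWeight γ μ x := by
  refine summable_of_ratio_test_tendsto_lt_one hμ1 ?_ ?_
  · filter_upwards [eventually_gt_atTop 0] with x hx
    have := meixnerWeight_pos hγ hμ0 x
    positivity
  · have h0 : Tendsto (fun x : ℕ => ((x : ℝ))⁻¹) atTop (𝓝 0) :=
      tendsto_inv_atTop_zero.comp tendsto_natCast_atTop_atTop
    have h1 : Tendsto (fun x : ℕ => (1 + (x : ℝ)⁻¹) ^ m *
        (μ * ((1 + γ * (x : ℝ)⁻¹) / (1 + (x : ℝ)⁻¹)))) atTop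
        (𝓝 ((1 + 0) ^ m * (μ * ((1 + γ * 0) / (1 + 0))))) :=
      ((h0.const_add 1).pow m).mul
        ((((h0.const_mul γ).const_add 1).div (h0.const_add 1) (by norm_num)).const_mul μ)
    simp only [add_zero, one_pow, mul_zero, div_one, mul_one, one_mul] at h1
    refine h1.congr' ?_
    filter_upwards [eventually_gt_atTop 0] with x hx
    have hx' : (0 : ℝ) < x := by exact_mod_cast hx
    have hw := meixnerWeight_pos hγ hμ0 x
    have hw' := meixnerWeight_pos hγ hμ0 (x + 1)
    have hs : meixnerWeight γ μ (x + 1) = μ * ((x + γ) * meixnerWeight γ μ x) / (x + 1) := by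
      rw [← succ_mul_meixnerWeight_succ]
      field_simp
    rw [Real.norm_of_nonneg (by positivity), Real.norm_of_nonneg (by positivity), hs]
    have : (1 + (x : ℝ)⁻¹) = (x + 1) / x := by field_simp
    rw [this, div_pow]
    push_cast
    field_simp

theorem summable_eval_mul_meixnerWeight {γ μ : ℝ} (hγ : 0 < γ) (hμ0 : 0 < μ) (hμ1 : μ < 1)
    (p : ℝ[X]) : Summable fun x : ℕ => p.eval (x : ℝ) * meixnerWeight γ μ x := by
  simp_rw [Polynomial.eval_eq_sum_range, Finset.sum_mul, mul_assoc]
  exact summable_sum fun m _ => (summable_pow_mul_meixnerWeight hγ hμ0 hμ1 m).mul_left _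

/-- The Meixner moment functional `p ↦ ∑_{x ≥ 0} p(x) μ^x (γ)_x / x!`. -/
def meixnerFunctional {γ μ : ℝ} (hγ : 0 < γ) (hμ0 : 0 < μ) (hμ1 : μ < 1) : ℝ[X] →ₗ[ℝ] ℝ where
  toFun p := ∑' x : ℕ, p.eval (x : ℝ) * meixnerWeight γ μ x
  map_add' p q := by
    simp only [Polynomial.eval_add, add_mul]
    exact (summable_eval_mul_meixnerWeight hγ hμ0 hμ1 p).tsum_add
      (summable_eval_mul_meixnerWeight hγ hμ0 hμ1 q)
  map_smul' c p := by
    simp only [Polynomial.eval_smul, smul_eq_mul, mul_assoc, RingHom.id_apply, tsum_mul_left]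

section Functional

variable {γ μ : ℝ} (hγ : 0 < γ) (hμ0 : 0 < μ) (hμ1 : μ < 1)

theorem mIP_eval (p q : ℝ[X]) :
    mIP γ μ (fun x => p.eval x) (fun x => q.eval x) = meixnerFunctional hγ hμ0 hμ1 (p * q) := by
  refine tsum_congr fun x => ?_
  rw [Polynomial.eval_mul, meixnerWeight]
  ring

theorem meixnerFunctional_mul_self_nonneg (p : ℝ[X]) :
    0 ≤ meixnerFunctional hγ hμ0 hμ1 (p * p) :=
  tsum_nonneg fun x => by
    have := meixnerWeight_pos hγ hμ0 x
    rw [Polynomial.eval_mul]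
    exact mul_nonneg (mul_self_nonneg _) this.le

theorem eq_zero_of_meixnerFunctional_mul_self {p : ℝ[X]}
    (h : meixnerFunctional hγ hμ0 hμ1 (p * p) = 0) : p = 0 := by
  have hs := (summable_eval_mul_meixnerWeight hγ hμ0 hμ1 (p * p)).hasSum
  change HasSum _ (meixnerFunctional hγ hμ0 hμ1 (p * p)) at hs
  rw [h, hasSum_zero_iff_of_nonneg] at hs
  · refine Polynomial.eq_zero_of_infinite_isRoot p
      ((Set.infinite_range_of_injective (Nat.cast_injective (R := ℝ))).mono ?_)
    rintro _ ⟨x, rfl⟩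
    have hx := congrFun hs x
    simpa [(meixnerWeight_pos hγ hμ0 x).ne'] using hx
  · intro x
    have := meixnerWeight_pos hγ hμ0 x
    rw [Polynomial.eval_mul]
    exact mul_nonneg (mul_self_nonneg _) this.le

theorem meixnerFunctional_X_mul (q : ℝ[X]) :
    meixnerFunctional hγ hμ0 hμ1 (X * q) =
      μ * meixnerFunctional hγ hμ0 hμ1 ((X + C γ) * q.comp (X + 1)) := by
  change ∑' x : ℕ, _ = μ * ∑' x : ℕ, _
  rw [(summable_eval_mul_meixnerWeight hγ hμ0 hμ1 (X * q)).tsum_eq_zero_add, ← tsum_mul_left]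
  simp only [Polynomial.eval_mul, Polynomial.eval_X, Nat.cast_zero, zero_mul, zero_add]
  refine tsum_congr fun x => ?_
  have := succ_mul_meixnerWeight_succ γ μ x
  simp only [Polynomial.eval_comp, Polynomial.eval_add, Polynomial.eval_X, Polynomial.eval_C,
    Polynomial.eval_one, Nat.cast_add, Nat.cast_one]
  linear_combination (q.eval ((x : ℝ) + 1)) * this

/-- The rising factorial `(x + γ)_m` as a polynomial in `x`. -/
def risingPoly (γ : ℝ) (m : ℕ) : ℝ[X] := (ascPochhammer ℝ m).comp (X + C γ)

theorem risingPoly_monic (γ : ℝ) (m : ℕ) : (risingPoly γ m).Monic :=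
  (monic_ascPochhammer ℝ m).comp_X_add_C γ

theorem risingPoly_natDegree (γ : ℝ) (m : ℕ) : (risingPoly γ m).natDegree = m := by
  rw [risingPoly, Polynomial.natDegree_comp, ascPochhammer_natDegree]
  simp

theorem risingPoly_succ (γ : ℝ) (m : ℕ) :
    risingPoly γ (m + 1) = (X + C γ) * (risingPoly γ m).comp (X + 1) := by
  simp only [risingPoly, ascPochhammer_succ_left, Polynomial.mul_comp, Polynomial.X_comp,
    Polynomial.comp_assoc, Polynomial.add_comp, Polynomial.one_comp, Polynomial.C_comp]
  congr 2
  ring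

theorem risingPoly_succ' (γ : ℝ) (m : ℕ) :
    risingPoly γ (m + 1) = X * risingPoly γ m + (γ + m) • risingPoly γ m := by
  rw [risingPoly, risingPoly, ascPochhammer_succ_right, Polynomial.smul_eq_C_mul]
  simp only [Polynomial.mul_comp, Polynomial.X_comp, Polynomial.add_comp,
    Polynomial.natCast_comp, map_add, map_natCast]
  ring

theorem meixnerFunctional_risingPoly (m : ℕ) :
    meixnerFunctional hγ hμ0 hμ1 (risingPoly γ m) =
      poch γ m / (1 - μ) ^ m * meixnerFunctional hγ hμ0 hμ1 1 := by
  have h1 : 1 - μ ≠ 0 := by linarith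
  induction m with
  | zero => simp [risingPoly, poch]
  | succ m ih =>
    have h := congrArg (meixnerFunctional hγ hμ0 hμ1) (risingPoly_succ' γ m)
    rw [map_add, map_smul, meixnerFunctional_X_mul, ← risingPoly_succ, ih, smul_eq_mul] at h
    rw [poch_succ]
    field_simp
    field_simp at h
    linear_combination h

theorem meixnerFunctional_descPochhammer_mul_risingPoly (k m : ℕ) :
    meixnerFunctional hγ hμ0 hμ1 (descPochhammer ℝ k * risingPoly γ m) =
      μ ^ k * (poch γ (k + m) / (1 - μ) ^ (k + m) * meixnerFunctional hγ hμ0 hμ1 1) := by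
  induction k generalizing m with
  | zero => simp [meixnerFunctional_risingPoly]
  | succ k ih =>
    have : ((descPochhammer ℝ k).comp (X - 1) * risingPoly γ m).comp (X + 1) =
        descPochhammer ℝ k * (risingPoly γ m).comp (X + 1) := by
      simp [Polynomial.mul_comp, Polynomial.comp_assoc]
    rw [descPochhammer_succ_left, mul_assoc, meixnerFunctional_X_mul, this, mul_left_comm,
      ← risingPoly_succ, ih, show k + 1 + m = k + (m + 1) by ring]
    ring

end Functional

/-- Coefficient of the falling factorial of degree `k` in the monic Meixner polynomial of
degree `n`. -/
def meixnerCoeff (γ μ : ℝ) (n k : ℕ) : ℝ :=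
  poch γ n * (μ / (μ - 1)) ^ n * ((n.choose k : ℝ) / poch γ k * (1 - μ⁻¹) ^ k)

/-- The monic Meixner polynomial as a `Polynomial`. -/
def meixnerPoly (γ μ : ℝ) (n : ℕ) : ℝ[X] :=
  ∑ k ∈ Finset.range (n + 1), meixnerCoeff γ μ n k • descPochhammer ℝ k

theorem meixnerM_eq_eval (γ μ : ℝ) (n : ℕ) :
    MeixnerM γ μ n = fun x => (meixnerPoly γ μ n).eval x := by
  ext x
  rw [MeixnerM, meixnerPoly, Polynomial.eval_finsetSum, Finset.mul_sum]
  refine Finset.sum_congr rfl fun k _ => ?_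
  have h := poch_neg_natCast_div_factorial n k
  have hs : ((-1 : ℝ) ^ k) * (-1) ^ k = 1 := by rw [← mul_pow]; simp
  rw [meixnerCoeff, Polynomial.eval_smul, smul_eq_mul, poch_neg x]
  calc _ = poch γ n * (μ / (μ - 1)) ^ n * ((poch (-(n : ℝ)) k / (k.factorial : ℝ)) *
        ((-1) ^ k * (descPochhammer ℝ k).eval x) / poch γ k * (1 - μ⁻¹) ^ k) := by ring
    _ = poch γ n * (μ / (μ - 1)) ^ n * ((((-1 : ℝ) ^ k) * (-1) ^ k) * (n.choose k : ℝ) *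
        (descPochhammer ℝ k).eval x / poch γ k * (1 - μ⁻¹) ^ k) := by rw [h]; ring
    _ = _ := by rw [hs]; ring

section Meixner

variable {γ μ : ℝ} (hγ : 0 < γ) (hμ0 : 0 < μ) (hμ1 : μ < 1)
include hγ hμ0 hμ1

theorem meixnerCoeff_self (n : ℕ) : meixnerCoeff γ μ n n = 1 := by
  have h1 : μ - 1 ≠ 0 := by linarith
  have := (poch_pos hγ n).ne'
  have h : μ / (μ - 1) * (1 - μ⁻¹) = 1 := by field_simp
  rw [meixnerCoeff, Nat.choose_self]
  calc _ = (μ / (μ - 1) * (1 - μ⁻¹)) ^ n * (poch γ n / poch γ n) := by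
        rw [mul_pow]; push_cast; ring
    _ = 1 := by rw [h, one_pow, div_self this, one_mul]

theorem meixnerPoly_eq_add (n : ℕ) : ∃ r : ℝ[X], r.degree < (n : WithBot ℕ) ∧
    meixnerPoly γ μ n = descPochhammer ℝ n + r := by
  refine ⟨∑ k ∈ Finset.range n, meixnerCoeff γ μ n k • descPochhammer ℝ k, ?_, ?_⟩
  · rw [← Polynomial.mem_degreeLT]
    refine Submodule.sum_mem _ fun k hk => Submodule.smul_mem _ _ ?_
    rw [Polynomial.mem_degreeLT]
    refine Polynomial.degree_le_natDegree.trans_lt ?_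
    rw [descPochhammer_natDegree]
    exact_mod_cast Finset.mem_range.1 hk
  · rw [meixnerPoly, Finset.sum_range_succ, meixnerCoeff_self hγ hμ0 hμ1, one_smul, add_comm]

theorem meixnerPoly_monic (n : ℕ) : (meixnerPoly γ μ n).Monic := by
  obtain ⟨r, hr, h⟩ := meixnerPoly_eq_add hγ hμ0 hμ1 n
  rw [h]
  refine (monic_descPochhammer ℝ n).add_of_left ?_
  rwa [Polynomial.degree_eq_natDegree (monic_descPochhammer ℝ n).ne_zero,
    descPochhammer_natDegree]

theorem meixnerPoly_natDegree (n : ℕ) : (meixnerPoly γ μ n).natDegree = n := by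
  obtain ⟨r, hr, h⟩ := meixnerPoly_eq_add hγ hμ0 hμ1 n
  have hd := Polynomial.degree_eq_natDegree (monic_descPochhammer ℝ n).ne_zero
  rw [descPochhammer_natDegree] at hd
  rw [h, Polynomial.natDegree_add_eq_left_of_degree_lt (by rwa [hd]), descPochhammer_natDegree]

theorem meixnerFunctional_meixnerPoly_mul_risingPoly {m n : ℕ} (hmn : m < n) :
    meixnerFunctional hγ hμ0 hμ1 (meixnerPoly γ μ n * risingPoly γ m) = 0 := by
  have h1 : 1 - μ ≠ 0 := by linarith
  have h2 : μ - 1 ≠ 0 := by linarith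
  have hz := congrFun (Polynomial.fwdDiff_iter_eq_zero_of_degree_lt
    (P := risingPoly γ m) (n := n) (by rwa [risingPoly_natDegree])) 0
  rw [fwdDiff_iter_eq_sum_shift] at hz
  rw [meixnerPoly, Finset.sum_mul, map_sum]
  have key : ∀ k ∈ Finset.range (n + 1),
      meixnerFunctional hγ hμ0 hμ1 (meixnerCoeff γ μ n k • descPochhammer ℝ k * risingPoly γ m) =
        (poch γ n * (μ / (μ - 1)) ^ n * (-1) ^ n / (1 - μ) ^ m *
          meixnerFunctional hγ hμ0 hμ1 1) *
        (((-1 : ℤ) ^ (n - k) * n.choose k) • (risingPoly γ m).eval ((0 : ℝ) + k • (1 : ℝ))) := by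
    intro k hk
    have hk' : k ≤ n := by simpa [Nat.lt_succ_iff] using hk
    have hp := (poch_pos hγ k).ne'
    have hev : (risingPoly γ m).eval ((0 : ℝ) + k • (1 : ℝ)) = poch (γ + k) m := by
      simp [risingPoly, poch_eq_eval_ascPochhammer, add_comm]
    have hsign : (-1 : ℝ) ^ n * (-1) ^ (n - k) = (-1) ^ k := by
      obtain ⟨l, rfl⟩ := Nat.exists_eq_add_of_le hk'
      rw [Nat.add_sub_cancel_left, pow_add, mul_assoc, ← mul_pow]
      simp
    have hmu : (1 - μ⁻¹) ^ k * μ ^ k / (1 - μ) ^ k = (-1) ^ k := by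
      rw [← mul_pow, ← div_pow]
      congr 1
      field_simp
      ring
    rw [hev, smul_mul_assoc, map_smul, meixnerFunctional_descPochhammer_mul_risingPoly,
      meixnerCoeff, poch_add, smul_eq_mul, zsmul_eq_mul, pow_add (1 - μ)]
    push_cast
    calc _ = poch γ n * (μ / (μ - 1)) ^ n * (n.choose k : ℝ) * (poch γ k / poch γ k) *
          ((1 - μ⁻¹) ^ k * μ ^ k / (1 - μ) ^ k) * poch (γ + k) m / (1 - μ) ^ m *
          meixnerFunctional hγ hμ0 hμ1 1 := by ring
      _ = _ := by rw [div_self hp, hmu, ← hsign]; ring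
  rw [Finset.sum_congr rfl key, ← Finset.mul_sum, hz]
  simp

theorem meixnerFunctional_meixnerPoly_mul {n : ℕ} {p : ℝ[X]} (hp : p.degree < (n : WithBot ℕ)) :
    meixnerFunctional hγ hμ0 hμ1 (meixnerPoly γ μ n * p) = 0 :=
  eq_zero_of_vanish_on_monic_family (risingPoly_monic γ) (risingPoly_natDegree γ)
    (meixnerFunctional hγ hμ0 hμ1 ∘ₗ LinearMap.mulLeft ℝ (meixnerPoly γ μ n)) n
    (fun _ hm => meixnerFunctional_meixnerPoly_mul_risingPoly hγ hμ0 hμ1 hm) p hp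

theorem degree_meixnerPoly (n : ℕ) : (meixnerPoly γ μ n).degree = n := by
  rw [Polynomial.degree_eq_natDegree (meixnerPoly_monic hγ hμ0 hμ1 n).ne_zero,
    meixnerPoly_natDegree hγ hμ0 hμ1]

theorem meixnerFunctional_meixnerPoly_mul_of_ne {m n : ℕ} (h : m ≠ n) :
    meixnerFunctional hγ hμ0 hμ1 (meixnerPoly γ μ m * meixnerPoly γ μ n) = 0 := by
  rcases h.lt_or_gt with h | h
  · rw [mul_comm]
    apply meixnerFunctional_meixnerPoly_mul
    rw [degree_meixnerPoly hγ hμ0 hμ1]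
    exact_mod_cast h
  · apply meixnerFunctional_meixnerPoly_mul
    rw [degree_meixnerPoly hγ hμ0 hμ1]
    exact_mod_cast h

theorem nrm2_eq (n : ℕ) :
    nrm2 γ μ n = meixnerFunctional hγ hμ0 hμ1 (meixnerPoly γ μ n * meixnerPoly γ μ n) := by
  rw [nrm2, meixnerM_eq_eval, mIP_eval hγ hμ0 hμ1]

theorem nrm2_pos (n : ℕ) : 0 < nrm2 γ μ n := by
  rw [nrm2_eq hγ hμ0 hμ1]
  refine (meixnerFunctional_mul_self_nonneg hγ hμ0 hμ1 _).lt_of_ne' fun h => ?_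
  exact (meixnerPoly_monic hγ hμ0 hμ1 n).ne_zero
    (eq_zero_of_meixnerFunctional_mul_self hγ hμ0 hμ1 h)

end Meixner

/-- The difference operator `𝒟_i` as a linear map. -/
def dopLinear (i : ℕ) : (ℝ → ℝ) →ₗ[ℝ] (ℝ → ℝ) where
  toFun := Dop i
  map_add' f g := by
    ext x
    simp only [Dop, Pi.add_apply]
    split_ifs <;> ring
  map_smul' c f := by
    ext x
    simp only [Dop, Pi.smul_apply, smul_eq_mul, RingHom.id_apply]
    split_ifs <;> ring

/-- The functional `p ↦ 𝒟_i^j p(α)` on polynomials. -/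
def differenceFunctional (i j : ℕ) (α : ℝ) : ℝ[X] →ₗ[ℝ] ℝ :=
  LinearMap.proj α ∘ₗ (dopLinear i ^ j) ∘ₗ LinearMap.pi fun x => Polynomial.leval x

theorem differenceFunctional_apply (i j : ℕ) (α : ℝ) (p : ℝ[X]) :
    differenceFunctional i j α p = Dk i j (fun x => p.eval x) α := by
  rw [differenceFunctional, LinearMap.comp_apply, LinearMap.comp_apply, Module.End.pow_apply]
  rfl

/-- The kernel `K_{n-1}^{(0,j)}(·, α)` as a polynomial, for the operator `𝒟_i`. -/
def meixnerKernelPoly (γ μ : ℝ) (i j n : ℕ) (α : ℝ) : ℝ[X] :=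
  ∑ k ∈ Finset.range n,
    (differenceFunctional i j α (meixnerPoly γ μ k) / nrm2 γ μ k) • meixnerPoly γ μ k

theorem eval_meixnerKernelPoly (γ μ : ℝ) (i j n : ℕ) (α x : ℝ) :
    (meixnerKernelPoly γ μ i j (n + 1) α).eval x = Klm γ μ i 0 j n x α := by
  rw [meixnerKernelPoly, Klm, Polynomial.eval_finsetSum]
  refine Finset.sum_congr rfl fun k _ => ?_
  rw [differenceFunctional_apply, meixnerM_eq_eval, Polynomial.eval_smul, smul_eq_mul,
    div_mul_eq_mul_div, mul_comm]
  rfl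

theorem differenceFunctional_meixnerKernelPoly (γ μ : ℝ) (i j n : ℕ) (α : ℝ) :
    differenceFunctional i j α (meixnerKernelPoly γ μ i j (n + 1) α) = Klm γ μ i j j n α α := by
  rw [meixnerKernelPoly, Klm, map_sum]
  refine Finset.sum_congr rfl fun k _ => ?_
  rw [map_smul, smul_eq_mul, differenceFunctional_apply, meixnerM_eq_eval, div_mul_eq_mul_div]

section Kernel

variable {γ μ : ℝ} (hγ : 0 < γ) (hμ0 : 0 < μ) (hμ1 : μ < 1)
include hγ hμ0 hμ1

theorem Klm_self_nonneg (i j n : ℕ) (α : ℝ) : 0 ≤ Klm γ μ i j j n α α :=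
  Finset.sum_nonneg fun k _ => div_nonneg (mul_self_nonneg _) (nrm2_pos hγ hμ0 hμ1 k).le

theorem degree_meixnerKernelPoly_lt (i j n : ℕ) (α : ℝ) :
    (meixnerKernelPoly γ μ i j n α).degree < (n : WithBot ℕ) := by
  rw [← Polynomial.mem_degreeLT]
  refine Submodule.sum_mem _ fun k hk => Submodule.smul_mem _ _ ?_
  rw [Polynomial.mem_degreeLT, degree_meixnerPoly hγ hμ0 hμ1]
  exact_mod_cast Finset.mem_range.1 hk

/-- Reproducing property of the kernel on the Meixner polynomials. -/
theorem meixnerFunctional_meixnerKernelPoly_mul (i j : ℕ) {n k : ℕ} (hk : k < n) (α : ℝ) :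
    meixnerFunctional hγ hμ0 hμ1 (meixnerKernelPoly γ μ i j n α * meixnerPoly γ μ k) =
      differenceFunctional i j α (meixnerPoly γ μ k) := by
  rw [meixnerKernelPoly, Finset.sum_mul, map_sum, Finset.sum_eq_single k]
  · rw [smul_mul_assoc, map_smul, smul_eq_mul, ← nrm2_eq hγ hμ0 hμ1,
      div_mul_cancel₀ _ (nrm2_pos hγ hμ0 hμ1 k).ne']
  · intro l _ hl
    rw [smul_mul_assoc, map_smul, meixnerFunctional_meixnerPoly_mul_of_ne hγ hμ0 hμ1 hl, smul_zero]
  · intro h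
    exact absurd (Finset.mem_range.2 hk) h

theorem IsSobolevOP.eq_sub_kernel {lam α : ℝ} {i j n : ℕ} {Q : ℝ[X]}
    (hQ : IsSobolevOP γ μ lam α i j n Q) :
    Q = meixnerPoly γ μ n -
      (lam * differenceFunctional i j α Q) • meixnerKernelPoly γ μ i j n α := by
  obtain ⟨hmonic, hdeg, horth⟩ := hQ
  set d := differenceFunctional i j α Q with hd
  set E := Q - meixnerPoly γ μ n + (lam * d) • meixnerKernelPoly γ μ i j n α with hE
  have hEdeg : E.degree < (n : WithBot ℕ) := by
    have h1 : (Q - meixnerPoly γ μ n).degree < (n : WithBot ℕ) := by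
      have hQd : Q.degree = n := by rw [Polynomial.degree_eq_natDegree hmonic.ne_zero, hdeg]
      rw [← hQd]
      exact Polynomial.degree_sub_lt_left (by rw [hQd, degree_meixnerPoly hγ hμ0 hμ1]) hmonic.ne_zero
        (by rw [hmonic.leadingCoeff, (meixnerPoly_monic hγ hμ0 hμ1 n).leadingCoeff])
    rw [← Polynomial.mem_degreeLT] at h1 ⊢
    exact Submodule.add_mem _ h1 (Submodule.smul_mem _ _
      (Polynomial.mem_degreeLT.2 (degree_meixnerKernelPoly_lt hγ hμ0 hμ1 i j n α)))
  have hEM : ∀ k < n, meixnerFunctional hγ hμ0 hμ1 (E * meixnerPoly γ μ k) = 0 := by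
    intro k hk
    have ho := horth (meixnerPoly γ μ k) (by
      rw [degree_meixnerPoly hγ hμ0 hμ1]
      exact_mod_cast hk)
    rw [sIP, mIP_eval hγ hμ0 hμ1, ← differenceFunctional_apply, ← differenceFunctional_apply,
      ← hd] at ho
    rw [hE, add_mul, sub_mul, smul_mul_assoc, map_add, map_sub, map_smul,
      meixnerFunctional_meixnerKernelPoly_mul hγ hμ0 hμ1 i j hk,
      meixnerFunctional_meixnerPoly_mul_of_ne hγ hμ0 hμ1 hk.ne', sub_zero, smul_eq_mul, ho]
  have hEE : meixnerFunctional hγ hμ0 hμ1 (E * E) = 0 :=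
    eq_zero_of_vanish_on_monic_family (meixnerPoly_monic hγ hμ0 hμ1)
      (meixnerPoly_natDegree hγ hμ0 hμ1)
      (meixnerFunctional hγ hμ0 hμ1 ∘ₗ LinearMap.mulLeft ℝ E) n hEM E hEdeg
  have hE0 := eq_zero_of_meixnerFunctional_mul_self hγ hμ0 hμ1 hEE
  linear_combination hE0

end Kernel

/-- connection formula for the Sobolev orthogonal polynomials. -/
theorem sobolev_connection_formula (γ μ lam α : ℝ) (hγ : 0 < γ) (hμ0 : 0 < μ)
    (hμ1 : μ < 1) (hlam : 0 < lam) (hα : α ≤ 0) (j i n : ℕ) (hi : i = 1 ∨ i = 2)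
    (hn : 1 ≤ n) (Q : Polynomial ℝ) (hQ : IsSobolevOP γ μ lam α i j n Q) :
    ∀ x : ℝ, Q.eval x =
      MeixnerM γ μ n x -
        lam * (Dk i j (MeixnerM γ μ n) α / (1 + lam * Klm γ μ i j j (n - 1) α α)) *
          Klm γ μ i 0 j (n - 1) x α := by
  intro x
  obtain ⟨n, rfl⟩ := Nat.exists_eq_add_of_le' hn
  rw [Nat.add_sub_cancel]
  have h := hQ.eq_sub_kernel hγ hμ0 hμ1
  have hK : 0 < 1 + lam * Klm γ μ i j j n α α := by
    have := Klm_self_nonneg hγ hμ0 hμ1 i j n α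
    positivity
  have hd := congrArg (differenceFunctional i j α) h
  rw [map_sub, map_smul, differenceFunctional_meixnerKernelPoly, smul_eq_mul] at hd
  have hd' : differenceFunctional i j α Q =
      Dk i j (MeixnerM γ μ (n + 1)) α / (1 + lam * Klm γ μ i j j n α α) := by
    rw [eq_div_iff hK.ne', meixnerM_eq_eval, ← differenceFunctional_apply]
    linear_combination hd
  have hx := congrArg (Polynomial.eval x) h
  rw [Polynomial.eval_sub, Polynomial.eval_smul, smul_eq_mul, eval_meixnerKernelPoly, hd'] at hx
  rw [hx, meixnerM_eq_eval]
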